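/- For every f ∈ C¹([-1,1]^d, ℝ), the quantity σ_f² = (1/2) ∑_{k∈ℕ^d} (k_1+…+k_d) f̂(k)² satisfies σ_f² ≤ (1/2) ∑_{α=1}^d ∫_{[-1,1]^d} (√(1−x_α²) ∂_α f(x))² μ_eq^{⊗d}(dx), with equality when f is a linear combination of monomials x_1^{a_1}…x_d^{a_d} with all a_j ∈ {0,1}. -/

import Mathlib

open MeasureTheory

/-- The normalized Chebyshev polynomials of the first kind on `[-1,1]`. -/
noncomputable def nT (k : ℕ) (x : ℝ) : ℝ :=
  if k = 0 then 1 else Real.sqrt 2 * Real.cos (k * Real.arccos x)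

/-- Density of the arcsine (equilibrium) measure `μ_eq` on `[-1,1]`. -/
noncomputable def weq (x : ℝ) : ℝ := 1 / (Real.pi * Real.sqrt (1 - x ^ 2))

/-- The hypercube `[-1,1]^d`. -/
def cube (d : ℕ) : Set (Fin d → ℝ) := Set.univ.pi fun _ => Set.Icc (-1 : ℝ) 1

/-- Multivariate Chebyshev coefficient `f̂(k) = ∫ f(x) ∏_j T_{k_j}(x_j) μ_eq^{⊗d}(dx)`. -/
noncomputable def fhat {d : ℕ} (f : (Fin d → ℝ) → ℝ) (k : Fin d → ℕ) : ℝ :=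
  ∫ x in cube d, f x * (∏ j, nT (k j) (x j)) * ∏ j, weq (x j)

/-- The limiting variance `σ_f² = (1/2) ∑_{k ∈ ℕ^d} (k_1 + … + k_d) f̂(k)²`. -/
noncomputable def sigmaSq {d : ℕ} (f : (Fin d → ℝ) → ℝ) : ℝ :=
  (1 / 2) * ∑' k : Fin d → ℕ, (∑ i, (k i : ℝ)) * (fhat f k) ^ 2

open Real Set

/-- The normalized Chebyshev polynomials in the angular variable: `nT k (cos t)` on `[0, π]`. -/
noncomputable def chebCos (k : ℕ) (t : ℝ) : ℝ := if k = 0 then 1 else √2 * cos (k * t)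

/-- The sine system conjugate to `chebCos`. -/
noncomputable def chebSin (k : ℕ) (t : ℝ) : ℝ := √2 * sin (k * t)

/-- The product of the functions `chebCos (k j)` in separate variables. -/
noncomputable def cosProd {d : ℕ} (k : Fin d → ℕ) (θ : Fin d → ℝ) : ℝ :=
  ∏ j, chebCos (k j) (θ j)

/-- `cosProd k` with the factor in the variable `α` replaced by its conjugate sine. -/
noncomputable def sinProd {d : ℕ} (α : Fin d) (k : Fin d → ℕ) (θ : Fin d → ℝ) : ℝ :=
  ∏ j, if j = α then chebSin (k j) (θ j) else chebCos (k j) (θ j)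

/-- The uniform probability measure on the box `[0, π]^d`. -/
noncomputable def angleMeasure (d : ℕ) : Measure (Fin d → ℝ) :=
  ENNReal.ofReal (π⁻¹ ^ d) • volume.restrict (Icc 0 fun _ => π)

/-! ### One-dimensional trigonometric systems -/

lemma nT_cos (k : ℕ) {t : ℝ} (ht : t ∈ Icc 0 π) : nT k (cos t) = chebCos k t := by
  simp [nT, chebCos, arccos_cos ht.1 ht.2]

lemma hasDerivAt_chebCos (k : ℕ) (t : ℝ) : HasDerivAt (chebCos k) (-(k * chebSin k t)) t := by
  unfold chebCos chebSin
  by_cases hk : k = 0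
  · simpa [hk] using hasDerivAt_const t (1 : ℝ)
  · simp only [hk, if_false]
    convert! (((hasDerivAt_id' t).const_mul (k : ℝ)).cos.const_mul (√2)) using 1
    ring

lemma hasDerivAt_chebSin (k : ℕ) (t : ℝ) : HasDerivAt (chebSin k) (k * chebCos k t) t := by
  unfold chebCos chebSin
  by_cases hk : k = 0
  · simpa [hk] using hasDerivAt_const t (0 : ℝ)
  · simp only [hk, if_false]
    convert! (((hasDerivAt_id' t).const_mul (k : ℝ)).sin.const_mul (√2)) using 1
    ring

lemma chebCos_of_le_one {k : ℕ} (hk : k ≤ 1) (t : ℝ) : chebCos k t = √2 ^ k * cos t ^ k := by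
  interval_cases k <;> simp [chebCos]

lemma integral_cos_int_mul (n : ℤ) :
    ∫ t in Icc 0 π, cos (n * t) = if n = 0 then π else 0 := by
  rw [integral_Icc_eq_integral_Ioc, ← intervalIntegral.integral_of_le pi_pos.le]
  split_ifs with h
  · simp [h]
  · rw [intervalIntegral.integral_comp_mul_left (fun t => cos t) (by exact_mod_cast h)]
    simp [sin_int_mul_pi]

lemma integrableOn_cos_int_mul (n : ℤ) :
    IntegrableOn (fun t : ℝ => cos (n * t)) (Icc 0 π) :=
  (by fun_prop : Continuous fun t : ℝ => cos (n * t)).integrableOn_Icc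

lemma integral_cos_mul_cos (j k : ℕ) :
    ∫ t in Icc 0 π, cos (j * t) * cos (k * t) =
      ((if (j : ℤ) - k = 0 then π else 0) + if (j : ℤ) + k = 0 then π else 0) / 2 := by
  rw [← integral_cos_int_mul, ← integral_cos_int_mul,
    ← integral_add (integrableOn_cos_int_mul _) (integrableOn_cos_int_mul _), ← integral_div]
  congr 1 with t
  push_cast
  rw [sub_mul, add_mul, cos_sub, cos_add]
  ring

lemma integral_sin_mul_sin (j k : ℕ) :
    ∫ t in Icc 0 π, sin (j * t) * sin (k * t) =
      ((if (j : ℤ) - k = 0 then π else 0) - if (j : ℤ) + k = 0 then π else 0) / 2 := by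
  rw [← integral_cos_int_mul, ← integral_cos_int_mul,
    ← integral_sub (integrableOn_cos_int_mul _) (integrableOn_cos_int_mul _), ← integral_div]
  congr 1 with t
  push_cast
  rw [sub_mul, add_mul, cos_sub, cos_add]
  ring

lemma integral_chebCos_mul_chebCos (j k : ℕ) :
    ∫ t in Icc 0 π, chebCos j t * chebCos k t = if j = k then π else 0 := by
  have key (c : ℝ) : ∫ t in Icc 0 π, c * (cos (j * t) * cos (k * t)) = c *
      (((if (j : ℤ) - k = 0 then π else 0) + if (j : ℤ) + k = 0 then π else 0) / 2) := by
    rw [integral_const_mul, integral_cos_mul_cos]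
  have hval : ∀ t, chebCos j t * chebCos k t =
      ((if j = 0 then 1 else √2) * (if k = 0 then 1 else √2)) * (cos (j * t) * cos (k * t)) := by
    intro t
    unfold chebCos
    by_cases hj : j = 0 <;> by_cases hk : k = 0 <;>
      simp only [hj, hk, if_true, if_false, Nat.cast_zero, zero_mul, cos_zero] <;> ring
  simp_rw [hval]
  rw [key]
  have h2 : √2 * √2 = 2 := mul_self_sqrt (by norm_num)
  rcases eq_or_ne j k with rfl | hjk
  · by_cases hj : j = 0
    · simp [hj]
    · simp only [hj, if_false, h2, sub_self, if_true]
      rw [if_neg (by lia)]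
      ring
  · have h₁ : (j : ℤ) - k ≠ 0 := by lia
    have h₂ : (j : ℤ) + k ≠ 0 := by lia
    simp [h₁, h₂, hjk]

lemma integral_chebSin_mul_chebSin (j k : ℕ) :
    ∫ t in Icc 0 π, chebSin j t * chebSin k t = if j = k ∧ j ≠ 0 then π else 0 := by
  have hval : ∀ t, chebSin j t * chebSin k t = 2 * (sin (j * t) * sin (k * t)) := by
    intro t
    have h2 : √2 * √2 = 2 := mul_self_sqrt (by norm_num)
    unfold chebSin
    linear_combination (sin (j * t) * sin (k * t)) * h2
  simp_rw [hval]
  rw [integral_const_mul, integral_sin_mul_sin]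
  rcases eq_or_ne j k with rfl | hjk
  · by_cases hj : j = 0
    · simp [hj]
    · rw [if_pos (by lia), if_neg (by lia), if_pos ⟨rfl, hj⟩]
      ring
  · rw [if_neg (by lia), if_neg (by lia), if_neg (by tauto)]
    simp

/-! ### Orthogonality of the product systems -/

lemma integrable_angleMeasure {d : ℕ} {g : (Fin d → ℝ) → ℝ} (hg : Continuous g) :
    Integrable g (angleMeasure d) :=
  Integrable.smul_measure hg.integrableOn_Icc ENNReal.ofReal_ne_top

lemma integral_angleMeasure {d : ℕ} (g : (Fin d → ℝ) → ℝ) :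
    ∫ θ, g θ ∂angleMeasure d = π⁻¹ ^ d * ∫ θ in Icc 0 fun _ => π, g θ := by
  rw [angleMeasure, integral_smul_measure, ENNReal.toReal_ofReal (by positivity), smul_eq_mul]

lemma integral_angleMeasure_prod {d : ℕ} (φ : Fin d → ℝ → ℝ) :
    ∫ θ, ∏ j, φ j (θ j) ∂angleMeasure d = ∏ j, (π⁻¹ * ∫ t in Icc 0 π, φ j t) := by
  rw [integral_angleMeasure, ← pi_univ_Icc, volume_pi, Measure.restrict_pi_pi,
    integral_fintype_prod_eq_prod, Finset.prod_mul_distrib]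
  simp

lemma integral_cosProd_mul_cosProd {d : ℕ} (k l : Fin d → ℕ) :
    ∫ θ, cosProd k θ * cosProd l θ ∂angleMeasure d = if k = l then 1 else 0 := by
  simp_rw [cosProd, ← Finset.prod_mul_distrib]
  rw [integral_angleMeasure_prod fun j t => chebCos (k j) t * chebCos (l j) t]
  simp_rw [integral_chebCos_mul_chebCos]
  split_ifs with h
  · simp [h, pi_ne_zero]
  · obtain ⟨i, hi⟩ := Function.ne_iff.1 h
    exact Finset.prod_eq_zero (Finset.mem_univ i) (by simp [hi])

lemma integral_sinProd_mul_sinProd {d : ℕ} (α : Fin d) (k l : Fin d → ℕ) :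
    ∫ θ, sinProd α k θ * sinProd α l θ ∂angleMeasure d = if k = l ∧ k α ≠ 0 then 1 else 0 := by
  simp_rw [sinProd, ← Finset.prod_mul_distrib]
  have hval : ∀ j, (π⁻¹ * ∫ t in Icc 0 π,
      (if j = α then chebSin (k j) t else chebCos (k j) t) *
        (if j = α then chebSin (l j) t else chebCos (l j) t)) =
      if k j = l j ∧ (j = α → k j ≠ 0) then 1 else 0 := by
    intro j
    by_cases hj : j = α
    · simp only [hj, if_true, integral_chebSin_mul_chebSin]
      split_ifs <;> simp_all [pi_ne_zero]
    · simp only [hj, if_false, integral_chebCos_mul_chebCos]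
      split_ifs <;> simp_all [pi_ne_zero]
  rw [integral_angleMeasure_prod fun j t =>
    (if j = α then chebSin (k j) t else chebCos (k j) t) *
      (if j = α then chebSin (l j) t else chebCos (l j) t)]
  simp_rw [hval]
  split_ifs with h
  · refine Finset.prod_eq_one fun j _ => if_pos ⟨by rw [h.1], ?_⟩
    rintro rfl
    exact h.2
  · by_cases hkl : k = l
    · exact Finset.prod_eq_zero (Finset.mem_univ α) (if_neg (by tauto))
    · obtain ⟨i, hi⟩ := Function.ne_iff.1 hkl
      exact Finset.prod_eq_zero (Finset.mem_univ i) (if_neg (by tauto))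

/-! ### Differentiation of the product systems and integration by parts -/

lemma hasFDerivAt_prod_apply {d : ℕ} {φ φ' : Fin d → ℝ → ℝ}
    (h : ∀ j t, HasDerivAt (φ j) (φ' j t) t) (θ : Fin d → ℝ) :
    HasFDerivAt (fun θ : Fin d → ℝ => ∏ j, φ j (θ j))
      (∑ i, (∏ j ∈ Finset.univ.erase i, φ j (θ j)) •
        (φ' i (θ i) • ContinuousLinearMap.proj (R := ℝ) (φ := fun _ : Fin d => ℝ) i)) θ :=
  HasFDerivAt.finsetProd fun i _ => (h i (θ i)).comp_hasFDerivAt θ (hasFDerivAt_apply i θ)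

lemma fderiv_prod_apply_single {d : ℕ} {φ φ' : Fin d → ℝ → ℝ}
    (h : ∀ j t, HasDerivAt (φ j) (φ' j t) t) (θ : Fin d → ℝ) (α : Fin d) :
    fderiv ℝ (fun θ : Fin d → ℝ => ∏ j, φ j (θ j)) θ (Pi.single α 1) =
      φ' α (θ α) * ∏ j ∈ Finset.univ.erase α, φ j (θ j) := by
  rw [(hasFDerivAt_prod_apply h θ).fderiv, sum_apply,
    Finset.sum_eq_single α]
  · simp [mul_comm]
  · intro i _ hi
    simp [hi]
  · simp

lemma hasDerivAt_sinProd_factor {d : ℕ} (α : Fin d) (k : Fin d → ℕ) (j : Fin d) (t : ℝ) :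
    HasDerivAt (fun t => if j = α then chebSin (k j) t else chebCos (k j) t)
      (if j = α then k j * chebCos (k j) t else -(k j * chebSin (k j) t)) t := by
  split_ifs
  exacts [hasDerivAt_chebSin _ _, hasDerivAt_chebCos _ _]

lemma differentiable_sinProd {d : ℕ} (α : Fin d) (k : Fin d → ℕ) :
    Differentiable ℝ (sinProd α k) := fun θ =>
  (hasFDerivAt_prod_apply (hasDerivAt_sinProd_factor α k) θ).differentiableAt

lemma differentiable_cosProd {d : ℕ} (k : Fin d → ℕ) : Differentiable ℝ (cosProd k) := fun θ =>
  (hasFDerivAt_prod_apply (fun j => hasDerivAt_chebCos (k j)) θ).differentiableAt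

lemma fderiv_sinProd_single {d : ℕ} (α : Fin d) (k : Fin d → ℕ) (θ : Fin d → ℝ) :
    fderiv ℝ (sinProd α k) θ (Pi.single α 1) = k α * cosProd k θ := by
  have h := fderiv_prod_apply_single (hasDerivAt_sinProd_factor α k) θ α
  rw [if_pos rfl] at h
  refine h.trans ?_
  rw [cosProd, ← Finset.mul_prod_erase _ _ (Finset.mem_univ α), mul_assoc]
  congr 2
  exact Finset.prod_congr rfl fun j hj => if_neg (Finset.ne_of_mem_erase hj)

lemma fderiv_cosProd_single {d : ℕ} (α : Fin d) (k : Fin d → ℕ) (θ : Fin d → ℝ) :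
    fderiv ℝ (cosProd k) θ (Pi.single α 1) = -(k α * sinProd α k θ) := by
  refine (fderiv_prod_apply_single (fun j => hasDerivAt_chebCos (k j)) θ α).trans ?_
  rw [sinProd, ← Finset.mul_prod_erase _ _ (Finset.mem_univ α), if_pos rfl, neg_mul, mul_assoc]
  congr 3
  exact Finset.prod_congr rfl fun j hj => (if_neg (Finset.ne_of_mem_erase hj)).symm

lemma sinProd_eq_zero {d : ℕ} {α : Fin d} (k : Fin d → ℕ) {θ : Fin d → ℝ}
    (h : θ α = 0 ∨ θ α = π) : sinProd α k θ = 0 := by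
  refine Finset.prod_eq_zero (Finset.mem_univ α) ?_
  rcases h with h | h <;> simp [h, chebSin, sin_nat_mul_pi]

lemma integral_fderiv_single_eq_zero {d : ℕ} {G : (Fin d → ℝ) → ℝ} (hG : Differentiable ℝ G)
    (α : Fin d) (hc : Continuous fun θ => fderiv ℝ G θ (Pi.single α 1))
    (h0 : ∀ θ, θ α = 0 ∨ θ α = π → G θ = 0) :
    ∫ θ, fderiv ℝ G θ (Pi.single α 1) ∂angleMeasure d = 0 := by
  obtain _ | n := d
  · exact α.elim0
  have hsum : ∀ θ, ∑ i, (if i = α then fderiv ℝ G θ else 0) (Pi.single i 1) =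
      fderiv ℝ G θ (Pi.single α 1) := by
    intro θ
    rw [Finset.sum_eq_single α] <;> simp +contextual
  have key := integral_divergence_of_hasFDerivAt_off_countable' (0 : Fin (n + 1) → ℝ)
    (fun _ => π) (fun _ => pi_pos.le) (fun i => if i = α then G else 0)
    (fun i θ => if i = α then fderiv ℝ G θ else 0) ∅ countable_empty
    (fun i => by
      split_ifs
      exacts [hG.continuous.continuousOn, continuousOn_const])
    (fun θ _ i => by
      split_ifs
      exacts [(hG θ).hasFDerivAt, hasFDerivAt_const _ _])
    (by simpa only [hsum] using hc.integrableOn_Icc)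
  simp only [hsum] at key
  rw [integral_angleMeasure, key, Finset.sum_eq_zero, mul_zero]
  intro i _
  by_cases hi : i = α
  · subst hi
    simp [h0]
  · simp [hi]

lemma integral_fderiv_mul_sinProd {d : ℕ} {F : (Fin d → ℝ) → ℝ} (hF : ContDiff ℝ 1 F)
    (α : Fin d) (k : Fin d → ℕ) :
    ∫ θ, fderiv ℝ F θ (Pi.single α 1) * sinProd α k θ ∂angleMeasure d =
      -(k α * ∫ θ, F θ * cosProd k θ ∂angleMeasure d) := by
  have hFd : Differentiable ℝ F := hF.differentiable one_ne_zero
  have hS := differentiable_sinProd α k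
  have hD : Continuous fun θ => fderiv ℝ F θ (Pi.single α 1) :=
    (hF.continuous_fderiv one_ne_zero).clm_apply continuous_const
  have hfd : ∀ θ, fderiv ℝ (fun θ => F θ * sinProd α k θ) θ (Pi.single α 1) =
      fderiv ℝ F θ (Pi.single α 1) * sinProd α k θ + k α * (F θ * cosProd k θ) := by
    intro θ
    rw [fderiv_fun_mul (hFd θ) (hS θ)]
    simp only [add_apply, smul_apply, fderiv_sinProd_single,
      smul_eq_mul]
    ring
  have h₁ : Continuous fun θ => fderiv ℝ F θ (Pi.single α 1) * sinProd α k θ :=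
    hD.mul hS.continuous
  have h₂ : Continuous fun θ => (k α : ℝ) * (F θ * cosProd k θ) :=
    continuous_const.mul (hFd.continuous.mul (differentiable_cosProd k).continuous)
  have key := integral_fderiv_single_eq_zero (hFd.mul hS) α
    (by
      change Continuous fun θ => fderiv ℝ (fun θ => F θ * sinProd α k θ) θ (Pi.single α 1)
      simp only [hfd]
      exact h₁.add h₂)
    fun θ hθ => by simp [sinProd_eq_zero k hθ]
  change ∫ θ, fderiv ℝ (fun θ => F θ * sinProd α k θ) θ (Pi.single α 1) ∂angleMeasure d = 0 at key
  simp only [hfd] at key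
  rw [integral_add (integrable_angleMeasure h₁) (integrable_angleMeasure h₂),
    integral_const_mul] at key
  linarith

/-! ### Bessel's inequality -/

lemma sum_sq_integral_mul_le {X ι : Type*} [MeasurableSpace X] [DecidableEq ι] {μ : Measure X}
    {g : X → ℝ} {e : ι → X → ℝ} (hg : Integrable (fun x => g x ^ 2) μ)
    (hge : ∀ i, Integrable (fun x => g x * e i x) μ)
    (hee : ∀ i j, Integrable (fun x => e i x * e j x) μ)
    (horth : ∀ i j, i ≠ j → ∫ x, e i x * e j x ∂μ = 0)
    (hnorm : ∀ i, ∫ x, e i x * e i x ∂μ ≤ 1) (s : Finset ι) :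
    ∑ i ∈ s, (∫ x, g x * e i x ∂μ) ^ 2 ≤ ∫ x, g x ^ 2 ∂μ := by
  set c : ι → ℝ := fun i => ∫ x, g x * e i x ∂μ
  have hexp : ∀ x, (g x - ∑ i ∈ s, c i * e i x) ^ 2 =
      g x ^ 2 - 2 * (∑ i ∈ s, c i * (g x * e i x)) +
        ∑ i ∈ s, ∑ j ∈ s, c i * c j * (e i x * e j x) := by
    intro x
    have h₁ : ∑ i ∈ s, c i * (g x * e i x) = g x * ∑ i ∈ s, c i * e i x := by
      rw [Finset.mul_sum]
      exact Finset.sum_congr rfl fun i _ => by ring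
    have h₂ : ∑ i ∈ s, ∑ j ∈ s, c i * c j * (e i x * e j x) = (∑ i ∈ s, c i * e i x) ^ 2 := by
      rw [sq, Finset.sum_mul_sum]
      exact Finset.sum_congr rfl fun i _ => Finset.sum_congr rfl fun j _ => by ring
    rw [h₁, h₂]
    ring
  have hi₁ : Integrable (fun x => 2 * ∑ i ∈ s, c i * (g x * e i x)) μ :=
    (integrable_finsetSum _ fun i _ => (hge i).const_mul _).const_mul _
  have hi₂ : Integrable (fun x => ∑ i ∈ s, ∑ j ∈ s, c i * c j * (e i x * e j x)) μ :=
    integrable_finsetSum _ fun i _ => integrable_finsetSum _ fun j _ => (hee i j).const_mul _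
  have hv₁ : ∫ x, 2 * ∑ i ∈ s, c i * (g x * e i x) ∂μ = 2 * ∑ i ∈ s, c i ^ 2 := by
    rw [integral_const_mul, integral_finsetSum _ fun i _ => (hge i).const_mul _]
    simp_rw [integral_const_mul, sq]
    rfl
  have hv₂ : ∫ x, ∑ i ∈ s, ∑ j ∈ s, c i * c j * (e i x * e j x) ∂μ ≤ ∑ i ∈ s, c i ^ 2 := by
    rw [integral_finsetSum _ fun i _ =>
      integrable_finsetSum _ fun j _ => (hee i j).const_mul _]
    refine Finset.sum_le_sum fun i hi => ?_
    rw [integral_finsetSum _ fun j _ => (hee i j).const_mul _, Finset.sum_eq_single_of_mem i hi]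
    · rw [integral_const_mul, ← sq]
      exact mul_le_of_le_one_right (sq_nonneg _) (hnorm i)
    · intro j _ hj
      rw [integral_const_mul, horth i j hj.symm, mul_zero]
  have hpos : 0 ≤ ∫ x, (g x - ∑ i ∈ s, c i * e i x) ^ 2 ∂μ :=
    integral_nonneg fun x => sq_nonneg _
  simp_rw [hexp] at hpos
  rw [integral_add (by exact hg.sub hi₁) hi₂, integral_sub hg hi₁, hv₁] at hpos
  linarith

/-! ### The substitution `x = cos θ` -/

lemma cos_mem_cube {d : ℕ} (θ : Fin d → ℝ) : (fun i => cos (θ i)) ∈ cube d :=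
  fun _ _ => ⟨neg_one_le_cos _, cos_le_one _⟩

lemma hasFDerivAt_cos_pi {d : ℕ} (θ : Fin d → ℝ) :
    HasFDerivAt (fun (θ : Fin d → ℝ) i => cos (θ i))
      (ContinuousLinearMap.pi fun i => ((-sin (θ i)) • ContinuousLinearMap.id ℝ ℝ).comp
        (ContinuousLinearMap.proj i)) θ := by
  refine hasFDerivAt_pi.2 fun i => ?_
  refine ((hasDerivAt_cos (θ i)).comp_hasFDerivAt θ
    (hasFDerivAt_apply (𝕜 := ℝ) (F' := fun _ : Fin d => ℝ) i θ)).congr_fderiv ?_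
  ext; simp

lemma image_cos_pi_Ioo (d : ℕ) :
    (fun (θ : Fin d → ℝ) i => cos (θ i)) '' (univ.pi fun _ => Ioo 0 π) =
      univ.pi fun _ => Ioo (-1) 1 := by
  have h : cos '' Ioo 0 π = Ioo (-1) 1 := by
    apply Subset.antisymm
    · rintro _ ⟨t, ht, rfl⟩
      constructor
      · rw [← cos_pi]
        exact strictAntiOn_cos ⟨ht.1.le, ht.2.le⟩ ⟨pi_pos.le, le_rfl⟩ ht.2
      · rw [← cos_zero]
        exact strictAntiOn_cos ⟨le_rfl, pi_pos.le⟩ ⟨ht.1.le, ht.2.le⟩ ht.1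
    · intro x hx
      exact ⟨arccos x, ⟨arccos_pos.2 hx.2, arccos_lt_pi.2 hx.1⟩, cos_arccos hx.1.le hx.2.le⟩
  have := piMap_image_univ_pi (fun _ : Fin d => cos) fun _ => Ioo 0 π
  simp only [h] at this
  exact this

lemma injOn_cos_pi_Ioo (d : ℕ) :
    InjOn (fun (θ : Fin d → ℝ) i => cos (θ i)) (univ.pi fun _ => Ioo 0 π) :=
  fun _ hθ _ hη h => funext fun i =>
    injOn_cos (Ioo_subset_Icc_self (hθ i trivial)) (Ioo_subset_Icc_self (hη i trivial))
      (congrFun h i)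

/-- The arcsine measure on the cube is the image of the uniform measure on angles. -/
lemma setIntegral_cube_mul_weq {d : ℕ} (h : (Fin d → ℝ) → ℝ) :
    ∫ x in cube d, h x * ∏ j, weq (x j) = ∫ θ, h (fun i => cos (θ i)) ∂angleMeasure d := by
  have hcube : (univ.pi fun _ => Ioo (-1) 1 : Set (Fin d → ℝ)) =ᵐ[volume] cube d :=
    Measure.pi_Ioo_ae_eq_pi_Icc
  have hbox : (univ.pi fun _ => Ioo 0 π : Set (Fin d → ℝ)) =ᵐ[volume] Icc 0 fun _ => π :=
    Measure.univ_pi_Ioo_ae_eq_Icc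
  have hmeas : MeasurableSet (univ.pi fun _ => Ioo 0 π : Set (Fin d → ℝ)) :=
    MeasurableSet.univ_pi fun _ => measurableSet_Ioo
  rw [← setIntegral_congr_set hcube, ← image_cos_pi_Ioo,
    integral_image_eq_integral_abs_det_fderiv_smul volume hmeas
      (fun θ _ => (hasFDerivAt_cos_pi θ).hasFDerivWithinAt) (injOn_cos_pi_Ioo d),
    integral_angleMeasure, ← setIntegral_congr_set hbox, ← integral_const_mul]
  refine setIntegral_congr_fun hmeas fun θ hθ => ?_
  have hdet : |(ContinuousLinearMap.pi fun i => ((-sin (θ i)) • ContinuousLinearMap.id ℝ ℝ).comp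
      (ContinuousLinearMap.proj (R := ℝ) (φ := fun _ : Fin d => ℝ) i)).det| =
      ∏ i, sin (θ i) := by
    rw [ContinuousLinearMap.det_pi, Finset.abs_prod]
    refine Finset.prod_congr rfl fun i _ => ?_
    have := sin_pos_of_mem_Ioo (hθ i trivial)
    simp [ContinuousLinearMap.det, abs_of_pos this]
  have hw : (∏ i, sin (θ i)) * ∏ i, weq (cos (θ i)) = π⁻¹ ^ d := by
    rw [← Finset.prod_mul_distrib, Finset.prod_eq_pow_card (b := π⁻¹)]
    · simp
    · intro i _
      have := sin_pos_of_mem_Ioo (hθ i trivial)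
      rw [weq, ← sin_eq_sqrt_one_sub_cos_sq (hθ i trivial).1.le (hθ i trivial).2.le]
      field_simp
  simp only [hdet, smul_eq_mul]
  rw [← hw]
  ring

lemma ae_mem_Icc_angleMeasure (d : ℕ) : ∀ᵐ θ ∂angleMeasure d, θ ∈ Icc 0 fun _ => π :=
  Measure.ae_smul_measure (ae_restrict_mem measurableSet_Icc) _

lemma contDiff_comp_cos {d : ℕ} {f : (Fin d → ℝ) → ℝ} (hf : ContDiffOn ℝ 1 f (cube d)) :
    ContDiff ℝ 1 fun θ : Fin d → ℝ => f fun i => cos (θ i) :=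
  hf.comp_contDiff (by fun_prop) cos_mem_cube

lemma fhat_eq_integral {d : ℕ} (f : (Fin d → ℝ) → ℝ) (k : Fin d → ℕ) :
    fhat f k = ∫ θ, f (fun i => cos (θ i)) * cosProd k θ ∂angleMeasure d := by
  rw [fhat, setIntegral_cube_mul_weq fun x => f x * ∏ j, nT (k j) (x j)]
  refine integral_congr_ae ?_
  filter_upwards [ae_mem_Icc_angleMeasure d] with θ hθ
  simp only [cosProd]
  congr 1
  exact Finset.prod_congr rfl fun j _ => nT_cos _ ⟨hθ.1 j, hθ.2 j⟩

lemma fderiv_comp_cos_single {d : ℕ} {f : (Fin d → ℝ) → ℝ} (hf : ContDiffOn ℝ 1 f (cube d))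
    (θ : Fin d → ℝ) (α : Fin d) :
    fderiv ℝ (fun θ : Fin d → ℝ => f fun i => cos (θ i)) θ (Pi.single α 1) =
      -sin (θ α) * fderivWithin ℝ f (cube d) (fun i => cos (θ i)) (Pi.single α 1) := by
  have h₁ := (hf.differentiableOn one_ne_zero _ (cos_mem_cube θ)).hasFDerivWithinAt
  have h₂ := (h₁.comp θ (hasFDerivAt_cos_pi θ).hasFDerivWithinAt
    (fun η _ => cos_mem_cube η : MapsTo _ univ _)).hasFDerivAt_of_univ
  have h₃ : (ContinuousLinearMap.pi fun i => ((-sin (θ i)) • ContinuousLinearMap.id ℝ ℝ).comp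
      (ContinuousLinearMap.proj (R := ℝ) (φ := fun _ : Fin d => ℝ) i)) (Pi.single α 1) =
      (-sin (θ α)) • Pi.single α 1 := by
    ext i
    rcases eq_or_ne i α with rfl | hi <;> simp [*]
  have h₄ := congrArg (fun L => L (Pi.single α 1)) h₂.fderiv
  simp only [ContinuousLinearMap.comp_apply, h₃, map_smul, smul_eq_mul] at h₄
  exact h₄

lemma dirichlet_eq_integral {d : ℕ} {f : (Fin d → ℝ) → ℝ} (hf : ContDiffOn ℝ 1 f (cube d))
    (α : Fin d) :
    ∫ x in cube d, (√(1 - (x α) ^ 2) * fderivWithin ℝ f (cube d) x (Pi.single α 1)) ^ 2 *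
        ∏ j, weq (x j) =
      ∫ θ, fderiv ℝ (fun θ : Fin d → ℝ => f fun i => cos (θ i)) θ (Pi.single α 1) ^ 2
        ∂angleMeasure d := by
  rw [setIntegral_cube_mul_weq fun x =>
    (√(1 - (x α) ^ 2) * fderivWithin ℝ f (cube d) x (Pi.single α 1)) ^ 2]
  congr 1 with θ
  rw [fderiv_comp_cos_single hf, mul_pow, mul_pow,
    sq_sqrt (sub_nonneg.2 (cos_sq_le_one _)), neg_sq, sin_sq]

/-! ### The Dirichlet form in terms of Chebyshev coefficients -/

lemma sum_sq_mul_fhat_le {d : ℕ} {f : (Fin d → ℝ) → ℝ} (hf : ContDiffOn ℝ 1 f (cube d))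
    (α : Fin d) (s : Finset (Fin d → ℕ)) :
    ∑ k ∈ s, (k α * fhat f k) ^ 2 ≤ ∫ x in cube d,
      (√(1 - (x α) ^ 2) * fderivWithin ℝ f (cube d) x (Pi.single α 1)) ^ 2 *
        ∏ j, weq (x j) := by
  have hF := contDiff_comp_cos hf
  have hD : Continuous fun θ =>
      fderiv ℝ (fun θ : Fin d → ℝ => f fun i => cos (θ i)) θ (Pi.single α 1) :=
    (hF.continuous_fderiv one_ne_zero).clm_apply continuous_const
  have hS := fun k => (differentiable_sinProd α k).continuous
  rw [dirichlet_eq_integral hf]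
  refine le_trans (le_of_eq ?_) (sum_sq_integral_mul_le (e := sinProd α)
    (integrable_angleMeasure (hD.pow 2)) (fun k => integrable_angleMeasure (hD.mul (hS k)))
    (fun k l => integrable_angleMeasure ((hS k).mul (hS l)))
    (fun k l hkl => ?_) (fun k => ?_) s)
  · refine Finset.sum_congr rfl fun k _ => ?_
    rw [integral_fderiv_mul_sinProd hF, neg_sq, fhat_eq_integral]
  · rw [integral_sinProd_mul_sinProd, if_neg (by tauto)]
  · rw [integral_sinProd_mul_sinProd]
    split_ifs <;> norm_num

lemma exists_comp_cos_eq_sum_cosProd {d : ℕ} {f : (Fin d → ℝ) → ℝ} {S : Finset (Fin d → ℕ)}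
    {c : (Fin d → ℕ) → ℝ} (hS : ∀ k ∈ S, ∀ i, k i ≤ 1)
    (hfc : ∀ x ∈ cube d, f x = ∑ k ∈ S, c k * ∏ i, (x i) ^ (k i)) :
    ∃ a : (Fin d → ℕ) → ℝ, ∀ θ : Fin d → ℝ,
      f (fun i => cos (θ i)) = ∑ k ∈ S, a k * cosProd k θ := by
  refine ⟨fun k => c k * (∏ i, √2 ^ k i)⁻¹, fun θ => ?_⟩
  rw [hfc _ (cos_mem_cube θ)]
  refine Finset.sum_congr rfl fun k hk => ?_
  have h : cosProd k θ = (∏ i, √2 ^ k i) * ∏ i, cos (θ i) ^ k i := by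
    rw [cosProd, ← Finset.prod_mul_distrib]
    exact Finset.prod_congr rfl fun i _ => chebCos_of_le_one (hS k hk i) _
  have h0 : ∏ i, √2 ^ k i ≠ 0 := by positivity
  rw [h]
  field_simp

lemma fhat_of_comp_cos_eq_sum {d : ℕ} {f : (Fin d → ℝ) → ℝ} {S : Finset (Fin d → ℕ)}
    {a : (Fin d → ℕ) → ℝ}
    (ha : ∀ θ : Fin d → ℝ, f (fun i => cos (θ i)) = ∑ k ∈ S, a k * cosProd k θ)
    (k : Fin d → ℕ) : fhat f k = if k ∈ S then a k else 0 := by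
  rw [fhat_eq_integral]
  simp_rw [ha, Finset.sum_mul, mul_assoc]
  have hint : ∀ l, Integrable (fun θ => a l * (cosProd l θ * cosProd k θ)) (angleMeasure d) :=
    fun l => (integrable_angleMeasure ((differentiable_cosProd l).continuous.mul
      (differentiable_cosProd k).continuous)).const_mul _
  rw [integral_finsetSum _ fun l _ => hint l]
  simp_rw [integral_const_mul, integral_cosProd_mul_cosProd]
  simp

lemma dirichlet_of_comp_cos_eq_sum {d : ℕ} {f : (Fin d → ℝ) → ℝ}
    (hf : ContDiffOn ℝ 1 f (cube d)) {S : Finset (Fin d → ℕ)} {a : (Fin d → ℕ) → ℝ}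
    (ha : ∀ θ : Fin d → ℝ, f (fun i => cos (θ i)) = ∑ k ∈ S, a k * cosProd k θ)
    (α : Fin d) :
    ∫ x in cube d, (√(1 - (x α) ^ 2) * fderivWithin ℝ f (cube d) x (Pi.single α 1)) ^ 2 *
        ∏ j, weq (x j) = ∑ k ∈ S, (k α : ℝ) ^ 2 * fhat f k ^ 2 := by
  have hF := contDiff_comp_cos hf
  set F : (Fin d → ℝ) → ℝ := fun θ => f fun i => cos (θ i)
  have hD : Continuous fun θ => fderiv ℝ F θ (Pi.single α 1) :=
    (hF.continuous_fderiv one_ne_zero).clm_apply continuous_const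
  have hfd : ∀ θ, fderiv ℝ F θ (Pi.single α 1) = ∑ k ∈ S, -(a k * k α) * sinProd α k θ := by
    intro θ
    rw [show F = fun θ => ∑ k ∈ S, a k * cosProd k θ from funext ha,
      fderiv_fun_sum fun k _ => ((differentiable_cosProd k) θ).const_mul _, sum_apply]
    refine Finset.sum_congr rfl fun k _ => ?_
    rw [fderiv_const_mul ((differentiable_cosProd k) θ), smul_apply, fderiv_cosProd_single,
      smul_eq_mul]
    ring
  have hsq : ∀ θ, fderiv ℝ F θ (Pi.single α 1) ^ 2 =
      ∑ k ∈ S, -(a k * k α) * (fderiv ℝ F θ (Pi.single α 1) * sinProd α k θ) := by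
    intro θ
    rw [sq]
    nth_rw 2 [hfd]
    rw [Finset.mul_sum]
    exact Finset.sum_congr rfl fun k _ => by ring
  rw [dirichlet_eq_integral hf]
  rw [integral_congr_ae (.of_forall hsq),
    integral_finsetSum _ fun k _ => (integrable_angleMeasure
      (hD.fun_mul (differentiable_sinProd α k).continuous)).const_mul _]
  refine Finset.sum_congr rfl fun k hk => ?_
  rw [integral_const_mul, integral_fderiv_mul_sinProd hF, ← fhat_eq_integral,
    fhat_of_comp_cos_eq_sum ha, if_pos hk]
  ring

/-- For `f ∈ C¹([-1,1]^d)`, `σ_f² ≤ (1/2) ∑_α ∫ (√(1−x_α²) ∂_α f(x))² μ_eq^{⊗d}(dx)`,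
with equality when `f` is a linear combination of monomials `x_1^{a_1} ⋯ x_d^{a_d}` with
all `a_j ∈ {0,1}`. -/
theorem limiting_variance_dirichlet_bound {d : ℕ} (f : (Fin d → ℝ) → ℝ)
    (hf : ContDiffOn ℝ 1 f (cube d)) :
    (sigmaSq f ≤
      (1 / 2) * ∑ α : Fin d, ∫ x in cube d,
        (Real.sqrt (1 - (x α) ^ 2) * fderivWithin ℝ f (cube d) x (Pi.single α 1)) ^ 2 *
          ∏ j, weq (x j)) ∧
    ((∃ S : Finset (Fin d → ℕ), ∃ c : (Fin d → ℕ) → ℝ,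
        (∀ k ∈ S, ∀ i, k i ≤ 1) ∧
        ∀ x ∈ cube d, f x = ∑ k ∈ S, c k * ∏ i, (x i) ^ (k i)) →
      sigmaSq f =
        (1 / 2) * ∑ α : Fin d, ∫ x in cube d,
          (Real.sqrt (1 - (x α) ^ 2) * fderivWithin ℝ f (cube d) x (Pi.single α 1)) ^ 2 *
            ∏ j, weq (x j)) := by
  refine ⟨?_, ?_⟩
  · refine mul_le_mul_of_nonneg_left (Real.tsum_le_of_sum_le (fun k => by positivity) fun s => ?_)
      (by norm_num)
    calc ∑ k ∈ s, (∑ i, (k i : ℝ)) * fhat f k ^ 2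
        ≤ ∑ k ∈ s, ∑ i, (k i * fhat f k) ^ 2 := by
          refine Finset.sum_le_sum fun k _ => ?_
          rw [Finset.sum_mul]
          refine Finset.sum_le_sum fun i _ => ?_
          rw [mul_pow]
          gcongr
          exact_mod_cast Nat.le_self_pow two_ne_zero (k i)
      _ = ∑ i, ∑ k ∈ s, (k i * fhat f k) ^ 2 := Finset.sum_comm
      _ ≤ _ := Finset.sum_le_sum fun α _ => sum_sq_mul_fhat_le hf α s
  · rintro ⟨S, c, hS, hfc⟩
    obtain ⟨a, ha⟩ := exists_comp_cos_eq_sum_cosProd hS hfc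
    simp_rw [dirichlet_of_comp_cos_eq_sum hf ha]
    rw [sigmaSq, tsum_eq_sum (s := S), Finset.sum_comm]
    · congr 1
      refine Finset.sum_congr rfl fun k hk => ?_
      rw [Finset.sum_mul]
      refine Finset.sum_congr rfl fun i _ => ?_
      have := hS k hk i
      interval_cases k i <;> simp
    · intro k hk
      simp [fhat_of_comp_cos_eq_sum ha, hk]
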